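/- arXiv:2008.06732 — 4 statements merged into one kernel-verified Lean document; each statement's English description precedes it below -/
import Mathlib

section
/- Bounds on the smooth component: there exists a constant C, depending only on a, f, T and α but not on ε, such that for every ε ∈ (0,1], the solution v of ε v' + a v = f with v(0) = f(0)/a(0) satisfies sup_{[0,T]} |v| ≤ C, sup_{[0,T]} |v'| ≤ C, and sup_{[0,T]} |v''| ≤ C ε⁻¹. -/
open Set

/-- One-sided maximum principle for `ε w' + a w = g`: the solution stays below any level `K` that
lies above `w 0` and strictly above `g / α`. -/
theorem le_of_first_order_ode {T α ε K M : ℝ} (hε : 0 < ε) (hK : 0 ≤ K) (hMK : M < α * K)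
    {a w w' g : ℝ → ℝ} (ha : ∀ t ∈ Icc (0:ℝ) T, α ≤ a t)
    (hw : ∀ t ∈ Icc (0:ℝ) T, HasDerivAt w (w' t) t)
    (heq : ∀ t ∈ Icc (0:ℝ) T, ε * w' t + a t * w t = g t)
    (hg : ∀ t ∈ Icc (0:ℝ) T, g t ≤ M) (h0 : w 0 ≤ K) :
    ∀ t ∈ Icc (0:ℝ) T, w t ≤ K := by
  intro t ht
  refine image_le_of_deriv_right_lt_deriv_boundary (f' := w') (B := fun _ => K) (B' := fun _ => 0)
    (fun x hx => (hw x hx).continuousAt.continuousWithinAt)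
    (fun x hx => (hw x (Ico_subset_Icc_self hx)).hasDerivWithinAt) h0
    (fun x => hasDerivAt_const x K) (fun x hx hxK => ?_) ht
  have hx := Ico_subset_Icc_self hx
  have h1 := heq x hx
  have h2 := hg x hx
  have h3 := mul_le_mul_of_nonneg_right (ha x hx) hK
  rw [hxK] at h1
  by_contra! h
  have h4 := mul_nonneg hε.le h
  linarith

/-- Maximum principle for `ε w' + a w = g` with `a ≥ α`. -/
theorem abs_le_of_first_order_ode {T α ε K M : ℝ} (hε : 0 < ε) (hK : 0 ≤ K) (hMK : M < α * K)
    {a w w' g : ℝ → ℝ} (ha : ∀ t ∈ Icc (0:ℝ) T, α ≤ a t)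
    (hw : ∀ t ∈ Icc (0:ℝ) T, HasDerivAt w (w' t) t)
    (heq : ∀ t ∈ Icc (0:ℝ) T, ε * w' t + a t * w t = g t)
    (hg : ∀ t ∈ Icc (0:ℝ) T, |g t| ≤ M) (h0 : |w 0| ≤ K) :
    ∀ t ∈ Icc (0:ℝ) T, |w t| ≤ K := by
  intro t ht
  refine abs_le'.2 ⟨?_, ?_⟩
  · exact le_of_first_order_ode hε hK hMK ha hw heq
      (fun x hx => (abs_le'.1 (hg x hx)).1) (abs_le'.1 h0).1 t ht
  · refine le_of_first_order_ode (w := fun x => -w x) (w' := fun x => -w' x) (g := fun x => -g x)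
      hε hK hMK ha (fun x hx => (hw x hx).neg) (fun x hx => ?_)
      (fun x hx => (abs_le'.1 (hg x hx)).2) (abs_le'.1 h0).2 t ht
    linarith [heq x hx]

/-- Differentiating `ε v' + a v = f` on a nondegenerate interval. -/
theorem deriv_eq_of_first_order_ode {T ε : ℝ} (hT : 0 < T) {a a' f f' v v' v'' : ℝ → ℝ}
    (ha : ∀ t ∈ Icc (0:ℝ) T, HasDerivAt a (a' t) t)
    (hf : ∀ t ∈ Icc (0:ℝ) T, HasDerivAt f (f' t) t)
    (hv : ∀ t ∈ Icc (0:ℝ) T, HasDerivAt v (v' t) t)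
    (hv' : ∀ t ∈ Icc (0:ℝ) T, HasDerivAt v' (v'' t) t)
    (heq : ∀ t ∈ Icc (0:ℝ) T, ε * v' t + a t * v t = f t) :
    ∀ t ∈ Icc (0:ℝ) T, ε * v'' t + a t * v' t = f' t - a' t * v t := by
  intro t ht
  have h1 : HasDerivAt (fun x => ε * v' x + a x * v x) (ε * v'' t + (a' t * v t + a t * v' t)) t :=
    ((hv' t ht).const_mul ε).add ((ha t ht).mul (hv t ht))
  have h2 : HasDerivWithinAt f (ε * v'' t + (a' t * v t + a t * v' t)) (Icc 0 T) t :=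
    h1.hasDerivWithinAt.congr (fun x hx => (heq x hx).symm) (heq t ht).symm
  have h3 := (uniqueDiffOn_Icc hT t ht).eq_deriv _ h2 (hf t ht).hasDerivWithinAt
  linarith

/-- Bounds on the smooth component, uniform in `ε`. -/
theorem smooth_component_bounds
    (T α : ℝ) (hT : 0 < T) (hα : 0 < α)
    (a a' f f' : ℝ → ℝ)
    (ha_deriv : ∀ t ∈ Set.Icc (0:ℝ) T, HasDerivAt a (a' t) t)
    (ha'_cont : ContinuousOn a' (Set.Icc 0 T))
    (ha : ∀ t ∈ Set.Icc (0:ℝ) T, α ≤ a t)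
    (hf_deriv : ∀ t ∈ Set.Icc (0:ℝ) T, HasDerivAt f (f' t) t)
    (hf'_cont : ContinuousOn f' (Set.Icc 0 T)) :
    ∃ C : ℝ, ∀ ε ∈ Set.Ioc (0:ℝ) 1, ∀ v v' v'' : ℝ → ℝ,
      (∀ t ∈ Set.Icc (0:ℝ) T, HasDerivAt v (v' t) t) →
      (∀ t ∈ Set.Icc (0:ℝ) T, HasDerivAt v' (v'' t) t) →
      (∀ t ∈ Set.Icc (0:ℝ) T, ε * v' t + a t * v t = f t) →
      v 0 = f 0 / a 0 →
      ∀ t ∈ Set.Icc (0:ℝ) T, |v t| ≤ C ∧ |v' t| ≤ C ∧ |v'' t| ≤ C * ε⁻¹ := by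
  have bound : ∀ g : ℝ → ℝ, ContinuousOn g (Icc 0 T) → ∃ B, ∀ t ∈ Icc (0:ℝ) T, |g t| ≤ B :=
    fun g hg => isCompact_Icc.exists_bound_of_continuousOn hg
  obtain ⟨A, hA⟩ := bound a fun x hx => (ha_deriv x hx).continuousAt.continuousWithinAt
  obtain ⟨A', hA'⟩ := bound a' ha'_cont
  obtain ⟨F, hF⟩ := bound f fun x hx => (hf_deriv x hx).continuousAt.continuousWithinAt
  obtain ⟨F', hF'⟩ := bound f' hf'_cont
  have h0T : (0:ℝ) ∈ Icc 0 T := ⟨le_rfl, hT.le⟩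
  have hA0 : 0 ≤ A := (abs_nonneg _).trans (hA 0 h0T)
  have hA'0 : 0 ≤ A' := (abs_nonneg _).trans (hA' 0 h0T)
  have hF0 : 0 ≤ F := (abs_nonneg _).trans (hF 0 h0T)
  have hF'0 : 0 ≤ F' := (abs_nonneg _).trans (hF' 0 h0T)
  have level : ∀ M, M < α * (M / α + 1) := fun M => by
    rw [mul_add, mul_div_cancel₀ _ hα.ne']
    linarith
  set K := F / α + 1
  have hK0 : 0 ≤ K := by positivity
  set M := F' + A' * K
  have hM0 : 0 ≤ M := by positivity
  set L := M / α + 1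
  have hL0 : 0 ≤ L := by positivity
  have hAL : 0 ≤ A * L := by positivity
  refine ⟨K + L + (M + A * L), fun ε hε v v' v'' hv hv' heq hv0 => ?_⟩
  have hεpos : 0 < ε := hε.1
  have ha0 : 0 < a 0 := hα.trans_le (ha 0 h0T)
  have hvK : ∀ t ∈ Icc (0:ℝ) T, |v t| ≤ K := by
    refine abs_le_of_first_order_ode hεpos hK0 (level F) ha hv heq hF ?_
    rw [hv0, abs_div, abs_of_pos ha0]
    have : |f 0| / a 0 ≤ F / α := div_le_div₀ hF0 (hF 0 h0T) hα (ha 0 h0T)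
    linarith
  have heq' := deriv_eq_of_first_order_ode hT ha_deriv hf_deriv hv hv' heq
  have hg : ∀ t ∈ Icc (0:ℝ) T, |f' t - a' t * v t| ≤ M := fun t ht => by
    have h1 := abs_sub (f' t) (a' t * v t)
    have h2 : |a' t * v t| ≤ A' * K := by
      rw [abs_mul]
      exact mul_le_mul (hA' t ht) (hvK t ht) (abs_nonneg _) hA'0
    linarith [hF' t ht]
  have hv'0 : v' 0 = 0 := by
    have h := heq 0 h0T
    rw [hv0, mul_div_cancel₀ _ ha0.ne'] at h
    exact (mul_eq_zero.1 (by linarith : ε * v' 0 = 0)).resolve_left hεpos.ne'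
  have hv'L : ∀ t ∈ Icc (0:ℝ) T, |v' t| ≤ L :=
    abs_le_of_first_order_ode hεpos hL0 (level M) ha hv' heq' hg (by simpa [hv'0] using hL0)
  intro t ht
  refine ⟨by linarith [hvK t ht], by linarith [hv'L t ht], ?_⟩
  rw [← div_eq_mul_inv, le_div_iff₀ hεpos]
  have h1 : |v'' t| * ε = |(f' t - a' t * v t) - a t * v' t| := by
    rw [← heq' t ht, add_sub_cancel_right, abs_mul, abs_of_pos hεpos, mul_comm]
  have h2 : |a t * v' t| ≤ A * L := by
    rw [abs_mul]
    exact mul_le_mul (hA t ht) (hv'L t ht) (abs_nonneg _) hA0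
  have h3 := abs_sub (f' t - a' t * v t) (a t * v' t)
  linarith [hg t ht]
end

section
/- Discrete stability: let 0 = t_0 < t_1 < ... < t_N = T be a mesh and Ψ : {0,...,N} → ℝ a mesh function. With L^N_σ Ψ(t_j) = ε σ_j (Ψ_j − Ψ_{j−1})/h_j + a(t_j) Ψ_j and σ_j > 0, one has for every 0 ≤ j ≤ N: |Ψ_j| ≤ max{ |Ψ_0|, (1/α) · max_{1 ≤ i ≤ N} |L^N_σ Ψ(t_i)| }. -/
open Set

/-- One step of the comparison argument for an implicit scheme `c * (x - y) + b * x = L`. -/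
lemma abs_le_of_implicit_step {b c x y α M : ℝ} (hα : 0 < α) (hb : α ≤ b) (hc : 0 < c)
    (hy : |y| ≤ M) (hL : |c * (x - y) + b * x| ≤ α * M) : |x| ≤ M := by
  have hM : 0 ≤ M := (abs_nonneg y).trans hy
  have hbM : α * M ≤ b * M := mul_le_mul_of_nonneg_right hb hM
  rw [abs_le] at hy hL ⊢
  constructor <;> nlinarith

/-- A sequence with increasing steps up to index `N` is monotone up to `N`. -/
lemma mesh_le_of_le {N : ℕ} {t : ℕ → ℝ}
    (hmesh : ∀ j : ℕ, 1 ≤ j → j ≤ N → t (j - 1) < t j) {i j : ℕ} (hij : i ≤ j) (hj : j ≤ N) :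
    t i ≤ t j := by
  induction j, hij using Nat.le_induction with
  | base => exact le_rfl
  | succ k _ ih => exact (ih (by omega)).trans (hmesh (k + 1) (by omega) hj).le

/-- Discrete stability of the fitted operator on a non-uniform mesh. -/
theorem discrete_stability
    (T α ε : ℝ) (hT : 0 < T) (hα : 0 < α) (hε : ε ∈ Set.Ioc (0:ℝ) 1)
    (a : ℝ → ℝ) (ha : ∀ t ∈ Set.Icc (0:ℝ) T, α ≤ a t)
    (N : ℕ) (hN : 1 ≤ N) (t : ℕ → ℝ)
    (ht0 : t 0 = 0) (htN : t N = T)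
    (hmesh : ∀ j : ℕ, 1 ≤ j → j ≤ N → t (j - 1) < t j)
    (σ : ℕ → ℝ) (hσ : ∀ j : ℕ, 1 ≤ j → j ≤ N → 0 < σ j)
    (Ψ : ℕ → ℝ) :
    ∀ j : ℕ, j ≤ N →
      |Ψ j| ≤ max |Ψ 0|
        ((1 / α) * (Finset.Icc 1 N).sup' (Finset.nonempty_Icc.mpr hN)
          (fun i => |ε * σ i * (Ψ i - Ψ (i - 1)) / (t i - t (i - 1)) + a (t i) * Ψ i|)) := by
  intro j
  induction j with
  | zero => exact fun _ => le_max_left _ _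
  | succ k ih =>
    intro hk
    have hh := hmesh (k + 1) (by omega) hk
    have hmem : t (k + 1) ∈ Set.Icc (0 : ℝ) T :=
      ⟨ht0 ▸ mesh_le_of_le hmesh (Nat.zero_le _) hk, htN ▸ mesh_le_of_le hmesh hk le_rfl⟩
    have hc : 0 < ε * σ (k + 1) / (t (k + 1) - t (k + 1 - 1)) :=
      div_pos (mul_pos hε.1 (hσ _ (by omega) hk)) (sub_pos.mpr hh)
    refine abs_le_of_implicit_step hα (ha _ hmem) hc (ih (by omega)) ?_
    rw [← div_le_iff₀' hα, div_eq_inv_mul, ← one_div]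
    refine le_trans ?_ (le_max_right _ _)
    refine mul_le_mul_of_nonneg_left ?_ (one_div_pos.mpr hα).le
    have hsup := Finset.le_sup'
      (fun i => |ε * σ i * (Ψ i - Ψ (i - 1)) / (t i - t (i - 1)) + a (t i) * Ψ i|)
      (Finset.mem_Icc.mpr ⟨Nat.le_add_left 1 k, hk⟩)
    simpa only [mul_div_right_comm, Nat.add_sub_cancel] using hsup
end

section
/- Truncation error for the smooth component: there exists a constant C, depending only on a, f, T and α but not on ε, N or the mesh, such that for every ε ∈ (0,1], every mesh 0 = t_0 < ... < t_N = T, and every j with 1 ≤ j ≤ N, the smooth component v (the solution of ε v' + a v = f, v(0) = f(0)/a(0)) satisfies |f(t_j) − L^N_σ v(t_j)| ≤ C h_j, where L^N_σ v(t_j) = ε σ_j (v(t_j) − v(t_{j−1}))/h_j + a(t_j) v(t_j). -/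
open Set

/-- One-sided maximum principle for `ε w' + a w = ε r` with `w 0 ≤ 0`. -/
lemma le_of_linear_ode {T α ε M : ℝ} (hα : 0 < α) (hε : 0 < ε) {a r w w' : ℝ → ℝ}
    (ha : ∀ t ∈ Icc (0:ℝ) T, α ≤ a t)
    (hr : ∀ t ∈ Icc (0:ℝ) T, |r t| < M)
    (hw : ∀ t ∈ Icc (0:ℝ) T, HasDerivAt w (w' t) t)
    (hode : ∀ t ∈ Icc (0:ℝ) T, ε * w' t + a t * w t = ε * r t)
    (hw0 : w 0 ≤ 0) : ∀ t ∈ Icc (0:ℝ) T, w t ≤ ε * M / α := by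
  intro t ht
  have hM : 0 < M := (abs_nonneg _).trans_lt (hr t ht)
  refine image_le_of_deriv_right_lt_deriv_boundary' (f' := w') (B' := fun _ => 0)
    (fun x hx => (hw x hx).continuousAt.continuousWithinAt)
    (fun x hx => (hw x (Ico_subset_Icc_self hx)).hasDerivWithinAt)
    (hw0.trans (by positivity)) continuousOn_const
    (fun x _ => hasDerivWithinAt_const _ _ _) ?_ ht
  intro x hx hwx
  have hx' := Ico_subset_Icc_self hx
  have hr' := (abs_lt.1 (hr x hx')).2
  have hlow : ε * M ≤ a x * w x := by
    rw [hwx]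
    calc ε * M = α * (ε * M / α) := by field_simp
      _ ≤ a x * (ε * M / α) := mul_le_mul_of_nonneg_right (ha x hx') (by positivity)
  have hneg : ε * w' x < 0 := by
    linarith [hode x hx', mul_lt_mul_of_pos_left hr' hε]
  exact neg_of_mul_neg_right hneg hε.le

/-- Stability estimate for `ε w' + a w = ε r` with `w 0 = 0`. -/
lemma abs_le_of_linear_ode {T α ε M : ℝ} (hα : 0 < α) (hε : 0 < ε) {a r w w' : ℝ → ℝ}
    (ha : ∀ t ∈ Icc (0:ℝ) T, α ≤ a t)
    (hr : ∀ t ∈ Icc (0:ℝ) T, |r t| < M)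
    (hw : ∀ t ∈ Icc (0:ℝ) T, HasDerivAt w (w' t) t)
    (hode : ∀ t ∈ Icc (0:ℝ) T, ε * w' t + a t * w t = ε * r t)
    (hw0 : w 0 = 0) : ∀ t ∈ Icc (0:ℝ) T, |w t| ≤ ε * M / α := by
  intro t ht
  have hneg : -w t ≤ ε * M / α :=
    le_of_linear_ode (r := fun x => -r x) (w := fun x => -w x) (w' := fun x => -w' x) hα hε ha
      (fun x hx => by simpa using hr x hx) (fun x hx => (hw x hx).neg)
      (fun x hx => by linarith [hode x hx]) (by simp [hw0]) t ht
  exact abs_le.2 ⟨by linarith, le_of_linear_ode hα hε ha hr hw hode hw0.le t ht⟩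

lemma abs_one_sub_div_exp_sub_one_le {x : ℝ} (hx : 0 < x) :
    |1 - x / (Real.exp x - 1)| ≤ x := by
  have hexp : 0 < Real.exp x - 1 := by linarith [Real.add_one_lt_exp hx.ne']
  have hle : x / (Real.exp x - 1) ≤ 1 := by
    rw [div_le_one hexp]
    linarith [Real.add_one_le_exp x]
  have hge : 1 - x ≤ x / (Real.exp x - 1) := by
    rw [le_div_iff₀ hexp]
    have h := mul_le_mul_of_nonneg_right (Real.one_sub_le_exp_neg x) (Real.exp_pos x).le
    rw [← Real.exp_add, neg_add_cancel, Real.exp_zero] at h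
    linarith
  rw [abs_of_nonneg (by linarith)]
  linarith

/-- Consistency of the fitted difference quotient on a single mesh interval `[s, t]`. -/
lemma abs_fitted_difference_le {ε A K P c s t : ℝ} (hε : 0 < ε) (hst : s < t)
    (hc : 0 < c) (hcA : c ≤ A) {v v' : ℝ → ℝ}
    (hv : ∀ x ∈ Icc s t, HasDerivAt v (v' x) x)
    (hP : ∀ x ∈ Icc s t, |v' x| ≤ P)
    (hK : ∀ x ∈ Icc s t, |ε * v' t - ε * v' x| ≤ K * (t - x)) :
    |ε * v' t - ε * (c * ((t - s) / ε) / (Real.exp (c * ((t - s) / ε)) - 1)) *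
      (v t - v s) / (t - s)| ≤ (K + A * P) * (t - s) := by
  obtain ⟨ξ, hξ, hslope⟩ := exists_hasDerivAt_eq_slope v v' hst
    (fun x hx => (hv x hx).continuousAt.continuousWithinAt)
    (fun x hx => hv x (Ioo_subset_Icc_self hx))
  have hξ' := Ioo_subset_Icc_self hξ
  have hh : 0 < t - s := sub_pos.2 hst
  have hP0 : 0 ≤ P := (abs_nonneg _).trans (hP ξ hξ')
  have hξt : 0 < t - ξ := sub_pos.2 hξ.2
  have hK0 : 0 ≤ K :=
    nonneg_of_mul_nonneg_left ((abs_nonneg _).trans (hK ξ hξ')) hξt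
  have hσ := abs_one_sub_div_exp_sub_one_le (x := c * ((t - s) / ε)) (by positivity)
  set σ := c * ((t - s) / ε) / (Real.exp (c * ((t - s) / ε)) - 1)
  have hsplit : ε * v' t - ε * σ * (v t - v s) / (t - s) =
      (ε * v' t - ε * v' ξ) + ε * (1 - σ) * v' ξ := by
    rw [mul_div_assoc, ← hslope]
    ring
  have hsecond : |ε * (1 - σ) * v' ξ| ≤ A * P * (t - s) := by
    rw [abs_mul, abs_mul, abs_of_pos hε]
    calc ε * |1 - σ| * |v' ξ| ≤ ε * (c * ((t - s) / ε)) * P := by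
          gcongr
          exact hP ξ hξ'
      _ = c * (t - s) * P := by field_simp
      _ ≤ A * (t - s) * P := by gcongr
      _ = A * P * (t - s) := by ring
  rw [hsplit]
  calc _ ≤ |ε * v' t - ε * v' ξ| + |ε * (1 - σ) * v' ξ| := abs_add_le _ _
    _ ≤ K * (t - s) + A * P * (t - s) :=
      add_le_add ((hK ξ hξ').trans (mul_le_mul_of_nonneg_left (by linarith [hξ.1]) hK0)) hsecond
    _ = _ := by ring

lemma le_of_mesh {N : ℕ} {t : ℕ → ℝ} (hmesh : ∀ j : ℕ, 1 ≤ j → j ≤ N → t (j - 1) < t j)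
    {i j : ℕ} (hij : i ≤ j) (hjN : j ≤ N) : t i ≤ t j := by
  induction j, hij using Nat.le_induction with
  | base => exact le_rfl
  | succ k _ ih => exact (ih (by omega)).trans (hmesh (k + 1) (by omega) hjN).le

/-- Truncation error of the fitted operator applied to the smooth component. -/
theorem truncation_error_smooth_component
    (T α : ℝ) (hT : 0 < T) (hα : 0 < α)
    (a a' f f' : ℝ → ℝ)
    (ha_deriv : ∀ t ∈ Set.Icc (0:ℝ) T, HasDerivAt a (a' t) t)
    (ha'_cont : ContinuousOn a' (Set.Icc 0 T))
    (ha : ∀ t ∈ Set.Icc (0:ℝ) T, α ≤ a t)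
    (hf_deriv : ∀ t ∈ Set.Icc (0:ℝ) T, HasDerivAt f (f' t) t)
    (hf'_cont : ContinuousOn f' (Set.Icc 0 T)) :
    ∃ C : ℝ, ∀ ε ∈ Set.Ioc (0:ℝ) 1, ∀ v v' v'' : ℝ → ℝ,
      (∀ t ∈ Set.Icc (0:ℝ) T, HasDerivAt v (v' t) t) →
      (∀ t ∈ Set.Icc (0:ℝ) T, HasDerivAt v' (v'' t) t) →
      (∀ t ∈ Set.Icc (0:ℝ) T, ε * v' t + a t * v t = f t) →
      v 0 = f 0 / a 0 →
      ∀ (N : ℕ), 1 ≤ N → ∀ t : ℕ → ℝ,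
        t 0 = 0 → t N = T → (∀ j : ℕ, 1 ≤ j → j ≤ N → t (j - 1) < t j) →
        ∀ j : ℕ, 1 ≤ j → j ≤ N →
          |f (t j) -
            (ε * (a (t j) * ((t j - t (j - 1)) / ε) /
                  (Real.exp (a (t j) * ((t j - t (j - 1)) / ε)) - 1)) *
                (v (t j) - v (t (j - 1))) / (t j - t (j - 1)) +
              a (t j) * v (t j))| ≤ C * (t j - t (j - 1)) := by
  have hapos : ∀ t ∈ Icc (0:ℝ) T, 0 < a t := fun t ht => hα.trans_le (ha t ht)
  have ha_cont : ContinuousOn a (Icc 0 T) :=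
    fun t ht => (ha_deriv t ht).continuousAt.continuousWithinAt
  have hf_cont : ContinuousOn f (Icc 0 T) :=
    fun t ht => (hf_deriv t ht).continuousAt.continuousWithinAt
  have hne : ∀ t ∈ Icc (0:ℝ) T, a t ≠ 0 := fun t ht => (hapos t ht).ne'
  obtain ⟨A, hA⟩ := isCompact_Icc.exists_bound_of_continuousOn ha_cont
  obtain ⟨A', hA'⟩ := isCompact_Icc.exists_bound_of_continuousOn ha'_cont
  obtain ⟨F', hF'⟩ := isCompact_Icc.exists_bound_of_continuousOn hf'_cont
  obtain ⟨B, hB⟩ := isCompact_Icc.exists_bound_of_continuousOn (hf_cont.div ha_cont hne)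
  obtain ⟨B', hB'⟩ := isCompact_Icc.exists_bound_of_continuousOn
    (((hf'_cont.mul ha_cont).sub (hf_cont.mul ha'_cont)).div (ha_cont.pow 2)
      (fun t ht => pow_ne_zero 2 (hne t ht)))
  simp only [Real.norm_eq_abs, Pi.div_apply] at hA hA' hF' hB hB'
  have h0 : (0:ℝ) ∈ Icc (0:ℝ) T := ⟨le_rfl, hT.le⟩
  have hA0 : 0 ≤ A := (abs_nonneg _).trans (hA 0 h0)
  have hA'0 : 0 ≤ A' := (abs_nonneg _).trans (hA' 0 h0)
  set M := B' + 1 with hM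
  have hM0 : 0 ≤ M := by linarith [(abs_nonneg _).trans (hB' 0 h0)]
  set P := A * (M / α) with hP
  set K := F' + (A' * (B + M / α) + A * P)
  refine ⟨K + A * P, ?_⟩
  intro ε hε v v' _ hv _ hode hv0 N _ t ht0 htN hmesh j hj1 hjN
  have hε0 : 0 < ε := hε.1
  have hw : ∀ x ∈ Icc (0:ℝ) T, |v x - f x / a x| ≤ ε * M / α := by
    refine abs_le_of_linear_ode (a := a) (w := fun x => v x - f x / a x)
      (w' := fun x => v' x - (f' x * a x - f x * a' x) / a x ^ 2)
      (r := fun x => -((f' x * a x - f x * a' x) / a x ^ 2)) hα hε0 ha ?_ ?_ ?_ ?_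
    · intro x hx
      rw [abs_neg]
      exact (hB' x hx).trans_lt (lt_add_one _)
    · exact fun x hx => (hv x hx).sub ((hf_deriv x hx).div (ha_deriv x hx) (hne x hx))
    · intro x hx
      have hcancel : a x * (f x / a x) = f x := mul_div_cancel₀ _ (hne x hx)
      linarith [hode x hx]
    · simp [hv0]
  have hv_le : ∀ x ∈ Icc (0:ℝ) T, |v x| ≤ B + M / α := by
    intro x hx
    have hεM : ε * M / α ≤ M / α := by
      gcongr
      exact mul_le_of_le_one_left hM0 hε.2
    calc |v x| = |f x / a x + (v x - f x / a x)| := by ring_nf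
      _ ≤ |f x / a x| + |v x - f x / a x| := abs_add_le _ _
      _ ≤ B + M / α := add_le_add (hB x hx) ((hw x hx).trans hεM)
  have hv'_le : ∀ x ∈ Icc (0:ℝ) T, |v' x| ≤ P := by
    intro x hx
    have hcancel : a x * (f x / a x) = f x := mul_div_cancel₀ _ (hne x hx)
    have heq : ε * v' x = -(a x * (v x - f x / a x)) := by linarith [hode x hx]
    refine le_of_mul_le_mul_left ?_ hε0
    calc ε * |v' x| = |ε * v' x| := by rw [abs_mul, abs_of_pos hε0]
      _ = |a x| * |v x - f x / a x| := by rw [heq, abs_neg, abs_mul]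
      _ ≤ A * (ε * M / α) := mul_le_mul (hA x hx) (hw x hx) (abs_nonneg _) hA0
      _ = ε * P := by rw [hP]; ring
  have hLip : ∀ x ∈ Icc (0:ℝ) T, ∀ y ∈ Icc (0:ℝ) T,
      |ε * v' y - ε * v' x| ≤ K * |y - x| := by
    intro x hx y hy
    have h := (convex_Icc (0:ℝ) T).norm_image_sub_le_of_norm_hasDerivWithin_le
      (f := fun z => f z - a z * v z) (f' := fun z => f' z - (a' z * v z + a z * v' z)) (C := K)
      (fun z hz => ((hf_deriv z hz).sub ((ha_deriv z hz).mul (hv z hz))).hasDerivWithinAt)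
      (fun z hz => ?_) hx hy
    · simp only [Real.norm_eq_abs] at h
      rwa [← hode x hx, ← hode y hy, add_sub_cancel_right, add_sub_cancel_right] at h
    · calc |f' z - (a' z * v z + a z * v' z)|
          ≤ |f' z| + |a' z * v z + a z * v' z| := abs_sub _ _
        _ ≤ |f' z| + (|a' z| * |v z| + |a z| * |v' z|) := by
          rw [← abs_mul, ← abs_mul]
          gcongr
          exact abs_add_le _ _
        _ ≤ K := add_le_add (hF' z hz) (add_le_add
          (mul_le_mul (hA' z hz) (hv_le z hz) (abs_nonneg _) hA'0)
          (mul_le_mul (hA z hz) (hv'_le z hz) (abs_nonneg _) hA0))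
  have hs0 : 0 ≤ t (j - 1) := ht0 ▸ le_of_mesh hmesh (Nat.zero_le _) (by omega)
  have htT : t j ≤ T := htN ▸ le_of_mesh hmesh hjN le_rfl
  have hst := hmesh j hj1 hjN
  have hsub : Icc (t (j - 1)) (t j) ⊆ Icc 0 T := Icc_subset_Icc hs0 htT
  have htj : t j ∈ Icc (0:ℝ) T := hsub ⟨hst.le, le_rfl⟩
  have hfit := abs_fitted_difference_le (A := A) hε0 hst (hapos _ htj)
    ((le_abs_self _).trans (hA _ htj)) (fun x hx => hv x (hsub hx))
    (fun x hx => hv'_le x (hsub hx))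
    (fun x hx => by
      simpa only [abs_of_nonneg (sub_nonneg.2 hx.2)] using hLip x (hsub hx) (t j) htj)
  convert hfit using 2
  linarith [hode _ htj]
end

section
/- Truncation error for the singular component: there exists a constant C, depending only on a, T, α and |w(0)| but not on ε, N or the mesh, such that for every ε ∈ (0,1], every mesh 0 = t_0 < ... < t_N = T, and every j with 1 ≤ j ≤ N, any differentiable solution w of ε w' + a w = 0 on [0,T] with w(0) ≥ 0 satisfies |L^N_σ w(t_j)| ≤ C h_j, where L^N_σ w(t_j) = ε σ_j (w(t_j) − w(t_{j−1}))/h_j + a(t_j) w(t_j). -/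
open Set

/-- Solutions of `ε w' + a w = 0` with `a ≥ 0` and `ε > 0` are bounded by their initial value. -/
theorem abs_le_abs_zero_of_singular_ode {T ε : ℝ} {a w w' : ℝ → ℝ} (hε : 0 < ε)
    (ha : ∀ t ∈ Icc (0 : ℝ) T, 0 ≤ a t)
    (hw : ∀ t ∈ Icc (0 : ℝ) T, HasDerivAt w (w' t) t)
    (hode : ∀ t ∈ Icc (0 : ℝ) T, ε * w' t + a t * w t = 0)
    {s : ℝ} (hs : s ∈ Icc (0 : ℝ) T) : |w s| ≤ |w 0| := by
  have hder : ∀ t ∈ Icc (0 : ℝ) T, HasDerivAt (fun x => w x ^ 2) (2 * w t * w' t) t := by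
    intro t ht
    simpa using (hw t ht).fun_pow 2
  have hanti : AntitoneOn (fun x => w x ^ 2) (Icc 0 T) := by
    refine antitoneOn_of_hasDerivWithinAt_nonpos (f' := fun t => 2 * w t * w' t)
      (convex_Icc 0 T) (fun t ht => (hder t ht).continuousAt.continuousWithinAt)
      (fun t ht => (hder t (interior_subset ht)).hasDerivWithinAt) fun t ht => ?_
    have ht' := interior_subset ht
    have hmul : ε * (2 * w t * w' t) = -(2 * (a t * w t ^ 2)) := by
      linear_combination 2 * w t * hode t ht'
    have hnonneg := mul_nonneg (ha t ht') (sq_nonneg (w t))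
    exact nonpos_of_mul_nonpos_right (by linarith) hε
  exact sq_le_sq.mp (hanti ⟨le_rfl, hs.1.trans hs.2⟩ hs hs.1)

/-- Freezing the coefficient of `ε w' + a w = 0` at the value `c` on `[p, q]`. -/
theorem abs_mul_exp_sub_le_of_singular_ode {ε c p q K W : ℝ} {a w w' : ℝ → ℝ}
    (hε : 0 < ε) (hc : 0 < c) (hpq : p ≤ q)
    (hw : ∀ t ∈ Icc p q, HasDerivAt w (w' t) t)
    (hode : ∀ t ∈ Icc p q, ε * w' t + a t * w t = 0)
    (hK : ∀ t ∈ Icc p q, |c - a t| ≤ K) (hW : ∀ t ∈ Icc p q, |w t| ≤ W) :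
    |w q * Real.exp (c * ((q - p) / ε)) - w p| ≤
      K * W / c * (Real.exp (c * ((q - p) / ε)) - 1) := by
  have hexp : ∀ t, HasDerivAt (fun x => Real.exp (c * ((x - p) / ε)))
      (Real.exp (c * ((t - p) / ε)) * (c * (1 / ε))) t := fun t =>
    ((((hasDerivAt_id t).sub_const p).div_const ε).const_mul c).exp
  have hf : ∀ t ∈ Icc p q, HasDerivAt (fun x => w x * Real.exp (c * ((x - p) / ε)) - w p)
      (w' t * Real.exp (c * ((t - p) / ε)) +
        w t * (Real.exp (c * ((t - p) / ε)) * (c * (1 / ε)))) t := fun t ht =>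
    ((hw t ht).mul (hexp t)).sub_const _
  have hB : ∀ t, HasDerivAt (fun x => K * W / c * (Real.exp (c * ((x - p) / ε)) - 1))
      (K * W / c * (Real.exp (c * ((t - p) / ε)) * (c * (1 / ε)))) t := fun t =>
    ((hexp t).sub_const 1).const_mul _
  refine image_norm_le_of_norm_deriv_right_le_deriv_boundary
    (fun t ht => (hf t ht).continuousAt.continuousWithinAt)
    (fun t ht => (hf t (Ico_subset_Icc_self ht)).hasDerivWithinAt) (by simp) hB
    (fun t ht => ?_) (right_mem_Icc.mpr hpq)
  have ht' := Ico_subset_Icc_self ht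
  have hw' : w' t = -(a t * w t) / ε := by
    rw [eq_div_iff hε.ne']
    linear_combination hode t ht'
  have hl : w' t * Real.exp (c * ((t - p) / ε)) +
      w t * (Real.exp (c * ((t - p) / ε)) * (c * (1 / ε))) =
      (c - a t) * w t * (Real.exp (c * ((t - p) / ε)) / ε) := by
    rw [hw']
    ring
  have hr : K * W / c * (Real.exp (c * ((t - p) / ε)) * (c * (1 / ε))) =
      K * W * (Real.exp (c * ((t - p) / ε)) / ε) := by
    field_simp
  have hpos : 0 < Real.exp (c * ((t - p) / ε)) / ε := by positivity
  rw [hl, hr, Real.norm_eq_abs, abs_mul, abs_mul, abs_of_pos hpos]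
  exact mul_le_mul_of_nonneg_right
    (mul_le_mul (hK t ht') (hW t ht') (abs_nonneg _) ((abs_nonneg _).trans (hK t ht'))) hpos.le

/-- Truncation error of the fitted operator applied to the singular component. -/
theorem truncation_error_singular_component
    (T α w0 : ℝ) (hT : 0 < T) (hα : 0 < α) (hw0 : 0 ≤ w0)
    (a a' : ℝ → ℝ)
    (ha_deriv : ∀ t ∈ Set.Icc (0:ℝ) T, HasDerivAt a (a' t) t)
    (ha'_cont : ContinuousOn a' (Set.Icc 0 T))
    (ha : ∀ t ∈ Set.Icc (0:ℝ) T, α ≤ a t) :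
    ∃ C : ℝ, ∀ ε ∈ Set.Ioc (0:ℝ) 1, ∀ w w' : ℝ → ℝ,
      (∀ t ∈ Set.Icc (0:ℝ) T, HasDerivAt w (w' t) t) →
      (∀ t ∈ Set.Icc (0:ℝ) T, ε * w' t + a t * w t = 0) →
      w 0 = w0 →
      ∀ (N : ℕ), 1 ≤ N → ∀ t : ℕ → ℝ,
        t 0 = 0 → t N = T → (∀ j : ℕ, 1 ≤ j → j ≤ N → t (j - 1) < t j) →
        ∀ j : ℕ, 1 ≤ j → j ≤ N →
          |ε * (a (t j) * ((t j - t (j - 1)) / ε) /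
                (Real.exp (a (t j) * ((t j - t (j - 1)) / ε)) - 1)) *
              (w (t j) - w (t (j - 1))) / (t j - t (j - 1)) +
            a (t j) * w (t j)| ≤ C * (t j - t (j - 1)) := by
  obtain ⟨M, hM⟩ := isCompact_Icc.exists_bound_of_continuousOn ha'_cont
  have hM0 : 0 ≤ M := (norm_nonneg _).trans (hM 0 ⟨le_rfl, hT.le⟩)
  refine ⟨M * w0, fun ε hε w w' hw hode hwi N _ t ht0 htN hmesh j hj hjN => ?_⟩
  have hmono : MonotoneOn t (Iic N) := by
    intro m _ n hn hmn
    induction n, hmn using Nat.le_induction with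
    | base => exact le_rfl
    | succ n _ ih =>
      have hn' : n + 1 ≤ N := hn
      exact (ih (Nat.le_of_succ_le hn')).trans (hmesh (n + 1) (by omega) hn').le
  have hp : 0 ≤ t (j - 1) :=
    ht0 ▸ hmono (Nat.zero_le N) ((Nat.sub_le j 1).trans hjN) (Nat.zero_le _)
  have hq : t j ≤ T := htN ▸ hmono hjN (le_refl N) hjN
  have hpq := hmesh j hj hjN
  generalize t (j - 1) = p at *
  generalize t j = q at *
  have hsub : Icc p q ⊆ Icc 0 T := Icc_subset_Icc hp hq
  have hqT : q ∈ Icc 0 T := hsub (right_mem_Icc.mpr hpq.le)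
  have hc : 0 < a q := hα.trans_le (ha q hqT)
  have hK : ∀ s ∈ Icc p q, |a q - a s| ≤ M * (q - p) := by
    intro s hs
    have hlip := (convex_Icc 0 T).norm_image_sub_le_of_norm_hasDerivWithin_le
      (fun x hx => (ha_deriv x hx).hasDerivWithinAt) hM (hsub hs) hqT
    rw [Real.norm_eq_abs, Real.norm_eq_abs, abs_of_nonneg (sub_nonneg.mpr hs.2)] at hlip
    exact hlip.trans (mul_le_mul_of_nonneg_left (by linarith [hs.1]) hM0)
  have hW : ∀ s ∈ Icc p q, |w s| ≤ w0 := by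
    intro s hs
    have hbound := abs_le_abs_zero_of_singular_ode hε.1 (fun x hx => hα.le.trans (ha x hx))
      hw hode (hsub hs)
    rwa [hwi, abs_of_nonneg hw0] at hbound
  have hkey := abs_mul_exp_sub_le_of_singular_ode hε.1 hc hpq.le
    (fun x hx => hw x (hsub hx)) (fun x hx => hode x (hsub hx)) hK hW
  have hh : 0 < q - p := sub_pos.mpr hpq
  have hε0 : ε ≠ 0 := hε.1.ne'
  have hE : 0 < Real.exp (a q * ((q - p) / ε)) - 1 :=
    sub_pos.mpr (Real.one_lt_exp_iff.mpr (mul_pos hc (div_pos hh hε.1)))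
  generalize Real.exp (a q * ((q - p) / ε)) = E at *
  have hL : ε * (a q * ((q - p) / ε) / (E - 1)) * (w q - w p) / (q - p) + a q * w q =
      a q / (E - 1) * (w q * E - w p) := by
    have hE0 := hE.ne'
    have hh0 := hh.ne'
    field_simp
    ring
  rw [hL, abs_mul, abs_of_pos (div_pos hc hE)]
  calc a q / (E - 1) * |w q * E - w p|
      ≤ a q / (E - 1) * (M * (q - p) * w0 / a q * (E - 1)) :=
        mul_le_mul_of_nonneg_left hkey (div_pos hc hE).le
    _ = M * w0 * (q - p) := by
        have hE0 := hE.ne'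
        field_simp
end
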